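/- Let m, n be integers with 1 < m < n and m even. Let G = {A ∈ GL(n, ℂ) : Aᵀ A = I and det A = 1} (the complex special orthogonal group SO(n,ℂ) with respect to the standard symmetric form), and let H = {A ∈ G : A e_i = e_i for every index i with m < i ≤ n}, where e_i is the i-th standard basis vector (H is the standard copy of SO(m,ℂ), consisting of the matrices diag(B, I_{n−m}) with B ∈ SO(m,ℂ)). Then there is no discrete subgroup Γ of G acting properly discontinuously and cocompactly on the homogeneous space G/H; that is, SO(n,ℂ)/SO(m,ℂ) admits no compact Clifford–Klein form when m is even. -/

import Mathlib

/-!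
The homogeneous space `SO(n,ℂ)/SO(m,ℂ)` admits no compact Clifford–Klein form
when `m` is even, `1 < m < n`.
-/

open Matrix

set_option maxHeartbeats 1000000
set_option synthInstance.maxHeartbeats 1000000

noncomputable section

/-- The complex special orthogonal group `SO(n, ℂ)`, realized as the subgroup of
`GL(n, ℂ)` of matrices `A` with `Aᵀ A = 1` and `det A = 1`. -/
def complexSO (n : ℕ) : Subgroup (GL (Fin n) ℂ) where
  carrier := {A | A.valᵀ * A.val = 1 ∧ A.val.det = 1}
  one_mem' := by constructor <;> simp
  mul_mem' := by
    rintro A B ⟨hA1, hA2⟩ ⟨hB1, hB2⟩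
    constructor
    · have key : (A * B).valᵀ * (A * B).val = B.valᵀ * (A.valᵀ * A.val) * B.val := by
        rw [Units.val_mul, transpose_mul]
        simp only [Matrix.mul_assoc]
      rw [key, hA1, Matrix.mul_one]
      exact hB1
    · rw [Units.val_mul, det_mul, hA2, hB2, mul_one]
  inv_mem' := by
    rintro A ⟨hA1, hA2⟩
    constructor
    · calc (A⁻¹).valᵀ * (A⁻¹).val
          = (A⁻¹).valᵀ * (A.valᵀ * A.val) * (A⁻¹).val := by rw [hA1, Matrix.mul_one]
        _ = (A.val * (A⁻¹).val)ᵀ * (A.val * (A⁻¹).val) := by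
            rw [transpose_mul]
            simp only [Matrix.mul_assoc]
        _ = 1 := by rw [Units.mul_inv]; simp
    · have h := congrArg Matrix.det (Units.mul_inv A)
      rw [det_mul, hA2, one_mul] at h
      simpa using h

/-- The standard copy of `SO(m,ℂ)` inside `SO(n,ℂ)`: the subgroup of elements fixing the
standard basis vectors `e_i` with `m < i ≤ n` (i.e., in the 0-based indexing of `Fin n`,
those with `m ≤ i`); such elements are exactly the block matrices `diag(B, I_{n-m})`
with `B ∈ SO(m,ℂ)`. -/
def complexSOsub (m n : ℕ) : Subgroup ↥(complexSO n) where
  carrier := {A | ∀ i : Fin n, m ≤ (i : ℕ) →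
      A.val.val *ᵥ Pi.single i 1 = Pi.single i 1}
  one_mem' := by
    intro i _
    show (1 : Matrix (Fin n) (Fin n) ℂ) *ᵥ Pi.single i 1 = Pi.single i 1
    rw [Matrix.one_mulVec]
  mul_mem' := by
    intro A B hA hB i hi
    have h : (A * B).val.val = A.val.val * B.val.val := rfl
    rw [h, ← Matrix.mulVec_mulVec, hB i hi, hA i hi]
  inv_mem' := by
    intro A hA i hi
    have h1 : (A⁻¹).val.val * A.val.val = 1 := by
      have h : (A⁻¹).val = (A.val)⁻¹ := rfl
      rw [h]
      exact Units.inv_mul A.val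
    calc (A⁻¹).val.val *ᵥ Pi.single i 1
        = (A⁻¹).val.val *ᵥ (A.val.val *ᵥ Pi.single i 1) := by rw [hA i hi]
      _ = Pi.single i 1 := by rw [Matrix.mulVec_mulVec, h1, Matrix.one_mulVec]

/-- A matrix `A` with `Aᵀ A = 1` and `det A = 1`, as an element of `complexSO n`. -/
def complexSO.ofMatrix {n : ℕ} (A : Matrix (Fin n) (Fin n) ℂ) (h : Aᵀ * A = 1)
    (hd : A.det = 1) : complexSO n :=
  ⟨⟨A, Aᵀ, mul_eq_one_comm.mp h, h⟩, h, hd⟩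

/-- The elements of `SO(n, ℂ)` all of whose entries have norm at most `R` form a compact set. -/
theorem complexSO.isCompact_entries_le (n : ℕ) (R : ℝ) :
    IsCompact {g : complexSO n | ∀ i j, ‖g.val.val i j‖ ≤ R} := by
  let S : Set (Matrix (Fin n) (Fin n) ℂ) :=
    {A | (Aᵀ * A = 1 ∧ A.det = 1) ∧ ∀ i j, ‖A i j‖ ≤ R}
  have hS : IsCompact S := by
    have hbox : IsCompact (Set.univ.pi fun _ : Fin n => Set.univ.pi fun _ : Fin n =>
        Metric.closedBall (0 : ℂ) R) :=
      isCompact_univ_pi fun _ => isCompact_univ_pi fun _ => isCompact_closedBall 0 R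
    have hclosed : IsClosed {A : Matrix (Fin n) (Fin n) ℂ | Aᵀ * A = 1 ∧ A.det = 1} :=
      (isClosed_eq (by fun_prop) continuous_const).inter
        (isClosed_eq (by fun_prop) continuous_const)
    refine (hbox.inter_left hclosed).of_isClosed_subset ?_ ?_
    · have : S = {A | Aᵀ * A = 1 ∧ A.det = 1} ∩ ⋂ i, ⋂ j, {A | ‖A i j‖ ≤ R} := by
        ext A
        simp [S]
      rw [this]
      refine hclosed.inter ?_
      exact isClosed_iInter fun i => isClosed_iInter fun j =>
        isClosed_le (by fun_prop) continuous_const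
    · rintro A ⟨hA, hb⟩
      exact ⟨hA, fun i _ j _ => by simpa using hb i j⟩
  have : CompactSpace S := isCompact_iff_compactSpace.mp hS
  let φ : S → complexSO n := fun A => complexSO.ofMatrix A.1 A.2.1.1 A.2.1.2
  have hφ : Continuous φ := by
    refine Continuous.subtype_mk (Units.continuous_iff.mpr ⟨?_, ?_⟩) _
    · exact continuous_subtype_val
    · exact continuous_subtype_val.matrix_transpose
  convert isCompact_range hφ
  ext g
  constructor
  · intro hg
    exact ⟨⟨g.val.val, g.2, hg⟩, Subtype.ext (Units.ext rfl)⟩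
  · rintro ⟨A, rfl⟩
    exact A.2.2

/-- If `Γ` acts cocompactly on `SO(n, ℂ) / H`, then `SO(n, ℂ) = Γ C H` for a bounded set `C`. -/
theorem complexSO.exists_bound_of_cocompact {n : ℕ} (Γ H : Subgroup (complexSO n))
    [CompactSpace (MulAction.orbitRel.Quotient Γ (complexSO n ⧸ H))] :
    ∃ R : ℝ, ∀ g : complexSO n, ∃ γ ∈ Γ, ∃ c : complexSO n, ∃ h ∈ H,
      (∀ i j, ‖c.val.val i j‖ ≤ R) ∧ g = γ * c * h := by
  let π : complexSO n → MulAction.orbitRel.Quotient Γ (complexSO n ⧸ H) :=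
    fun g => Quotient.mk _ (g : complexSO n ⧸ H)
  have : ContinuousConstSMul Γ (complexSO n ⧸ H) :=
    ⟨fun γ => continuous_const_smul (γ : complexSO n)⟩
  have hπ : IsOpenMap π :=
    (isOpenMap_quotient_mk'_mul (Γ := Γ) (T := complexSO n ⧸ H)).comp
      QuotientGroup.isOpenMap_coe
  let U : ℕ → Set (complexSO n) := fun R => {g | ∀ i j, ‖g.val.val i j‖ < R}
  have hU : ∀ R, IsOpen (U R) := by
    intro R
    simp only [U, Set.ofPred_forall]
    refine isOpen_iInter_of_finite fun i => isOpen_iInter_of_finite fun j =>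
      isOpen_lt ?_ continuous_const
    exact ((Units.continuous_val.comp continuous_subtype_val).matrix_elem i j).norm
  have hmono : Monotone U := fun a b hab g hg i j =>
    (hg i j).trans_le (by exact_mod_cast hab)
  have hcover : ∀ g : complexSO n, ∃ R, g ∈ U R := by
    intro g
    obtain ⟨R, hR⟩ := exists_nat_gt (∑ i, ∑ j, ‖g.val.val i j‖)
    refine ⟨R, fun i j => lt_of_le_of_lt ?_ hR⟩
    exact (Finset.single_le_sum (f := fun j => ‖g.val.val i j‖)
      (fun _ _ => norm_nonneg _) (Finset.mem_univ j)).trans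
      (Finset.single_le_sum (f := fun i => ∑ j, ‖g.val.val i j‖)
      (fun _ _ => Finset.sum_nonneg fun _ _ => norm_nonneg _) (Finset.mem_univ i))
  have hsurj : ∀ x, ∃ g, π g = x := by
    intro x
    induction x using Quotient.inductionOn with
    | h y =>
      obtain ⟨g, rfl⟩ := QuotientGroup.mk_surjective y
      exact ⟨g, rfl⟩
  obtain ⟨R, hR⟩ := isCompact_univ.elim_directed_cover (fun R => π '' U R)
    (fun R => hπ _ (hU R))
    (fun x _ => by
      obtain ⟨g, rfl⟩ := hsurj x
      obtain ⟨R, hR⟩ := hcover g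
      exact Set.mem_iUnion.mpr ⟨R, g, hR, rfl⟩)
    (directed_of_isDirected_le fun a b hab => Set.image_mono (hmono hab))
  refine ⟨R, fun g => ?_⟩
  obtain ⟨c, hc, hcg⟩ := hR (Set.mem_univ (π g))
  obtain ⟨γ, hγ⟩ : ((c : complexSO n ⧸ H)) ∈ MulAction.orbit Γ (g : complexSO n ⧸ H) :=
    MulAction.orbitRel_apply.mp (Quotient.exact hcg)
  have hγ' : ((γ.1 * g : complexSO n) : complexSO n ⧸ H) = c := hγ
  refine ⟨γ.1⁻¹, Γ.inv_mem γ.2, c, _, QuotientGroup.eq.mp hγ'.symm,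
    fun i j => (hc i j).le, by group⟩

/-- For `0 < m`, a real unit vector `v` supported on the first `m + 1` coordinates is the image of
the basis vector with index `m` under a real rotation fixing the later basis vectors. -/
theorem complexSO.exists_rotation {m n : ℕ} (hm : 0 < m) (hmn : m < n) (v : Fin n → ℝ)
    (hv : v ⬝ᵥ v = 1) (hsupp : ∀ i : Fin n, m < (i : ℕ) → v i = 0) :
    ∃ k : complexSO n, (∀ i j, ‖k.val.val i j‖ ≤ 1) ∧
      k.val.val *ᵥ Pi.single ⟨m, hmn⟩ 1 = (fun i => (v i : ℂ)) ∧
      ∀ i : Fin n, m < (i : ℕ) → k.val.val *ᵥ Pi.single i 1 = Pi.single i 1 := by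
  classical
  let w : Fin n → EuclideanSpace ℝ (Fin n) := fun i =>
    if i = ⟨m, hmn⟩ then WithLp.toLp 2 v else EuclideanSpace.single i 1
  let s : Set (Fin n) := {i | m ≤ (i : ℕ)}
  have hw : Orthonormal ℝ (s.domRestrict w) := by
    rw [orthonormal_iff_ite]
    rintro ⟨i, hi⟩ ⟨j, hj⟩
    have key : ∀ i : Fin n, m ≤ (i : ℕ) → i ≠ ⟨m, hmn⟩ → v i = 0 := fun i hi hne =>
      hsupp i (lt_of_le_of_ne hi fun h => hne (Fin.ext h.symm))
    simp only [Set.domRestrict_apply, Subtype.mk.injEq]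
    change inner ℝ (w i) (w j) = _
    simp only [w]
    by_cases h1 : i = ⟨m, hmn⟩ <;> by_cases h2 : j = ⟨m, hmn⟩
    · rw [if_pos h1, if_pos h2, if_pos (h1.trans h2.symm)]
      rw [EuclideanSpace.inner_eq_star_dotProduct]
      simpa using hv
    · rw [if_pos h1, if_neg h2, if_neg (by rintro rfl; exact h2 h1)]
      simp [EuclideanSpace.inner_single_right, key j hj h2]
    · rw [if_neg h1, if_pos h2, if_neg (by rintro rfl; exact h1 h2)]
      simp [EuclideanSpace.inner_single_left, key i hi h1]
    · rw [if_neg h1, if_neg h2]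
      simp [EuclideanSpace.inner_single_left]
  obtain ⟨b, hb⟩ := hw.exists_orthonormalBasis_extension_of_card_eq (by simp)
  let Q : Matrix (Fin n) (Fin n) ℝ := Matrix.of fun i j => b j i
  have hQ : Qᵀ * Q = 1 := by
    ext i j
    have := orthonormal_iff_ite.mp b.orthonormal i j
    rw [Matrix.mul_apply, Matrix.one_apply, ← this, PiLp.inner_apply]
    simp [Q, mul_comm]
  have hQd : Q.det * Q.det = 1 := by simpa using congrArg Matrix.det hQ
  let d : Fin n → ℝ := Function.update 1 ⟨0, hm.trans hmn⟩ Q.det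
  have hdd : ∀ i, d i * d i = 1 := by
    intro i
    by_cases h : i = ⟨0, hm.trans hmn⟩
    · subst h; simpa [d] using hQd
    · simp [d, h]
  have hds : ∀ i : Fin n, m ≤ (i : ℕ) → d i = 1 := by
    intro i hi
    have : i ≠ ⟨0, hm.trans hmn⟩ := by rintro rfl; simp at hi; omega
    simp [d, this]
  let P : Matrix (Fin n) (Fin n) ℝ := Q * Matrix.diagonal d
  have hP : Pᵀ * P = 1 := by
    calc Pᵀ * P = Matrix.diagonal d * (Qᵀ * Q) * Matrix.diagonal d := by
          simp only [P, Matrix.transpose_mul, Matrix.diagonal_transpose, Matrix.mul_assoc]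
      _ = 1 := by
          rw [hQ, Matrix.mul_one, Matrix.diagonal_mul_diagonal]
          simp [hdd]
  have hPd : P.det = 1 := by
    have : ∏ i, d i = Q.det := by
      simp only [d]
      rw [Finset.prod_update_of_mem (Finset.mem_univ _)]
      simp
    rw [Matrix.det_mul, Matrix.det_diagonal, this, hQd]
  have hPcol : ∀ i : Fin n, m ≤ (i : ℕ) → ∀ j, P j i = w i j := by
    intro i hi j
    simp [P, Q, hds i hi, hb i hi]
  let C : Matrix (Fin n) (Fin n) ℂ := P.map Complex.ofRealHom
  have hC : Cᵀ * C = 1 := by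
    rw [show Cᵀ = Pᵀ.map Complex.ofRealHom from rfl, ← Matrix.map_mul, hP]
    simp
  have hCd : C.det = 1 := by
    have := Complex.ofRealHom.map_det P
    rw [hPd] at this
    simpa [C] using this.symm
  refine ⟨complexSO.ofMatrix C hC hCd, ?_, ?_, ?_⟩
  · intro i j
    have h1 : ∑ l, P l j * P l j = 1 := by
      simpa [Matrix.mul_apply] using congrFun (congrFun hP j) j
    have h2 : P i j * P i j ≤ 1 := h1 ▸
      Finset.single_le_sum (f := fun l => P l j * P l j)
        (fun l _ => mul_self_nonneg _) (Finset.mem_univ i)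
    have h3 : |P i j| ≤ 1 := abs_le_one_iff_mul_self_le_one.mpr h2
    simpa [complexSO.ofMatrix, C] using h3
  · ext j
    simp [complexSO.ofMatrix, C, hPcol ⟨m, hmn⟩ le_rfl, w]
  · intro i hi
    have hne : i ≠ ⟨m, hmn⟩ := by rintro rfl; simp at hi
    ext j
    simp [complexSO.ofMatrix, C, hPcol i hi.le, w, hne, Pi.single_apply]

/-- For even `m`, an element of `SO(m + 1, ℂ)` maps some real unit vector of `ℝ^(m + 1)` to a real
unit vector. -/
theorem complexSO.exists_real_vector {m n : ℕ} (hmn : m < n) (heven : Even m)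
    (g : complexSO n) (hg : g ∈ complexSOsub (m + 1) n) :
    ∃ v u : Fin n → ℝ, v ⬝ᵥ v = 1 ∧ u ⬝ᵥ u = 1 ∧
      (∀ i : Fin n, m < (i : ℕ) → v i = 0) ∧ (∀ i : Fin n, m < (i : ℕ) → u i = 0) ∧
      g.val.val *ᵥ (fun i => (v i : ℂ)) = fun i => (u i : ℂ) := by
  let A : Matrix (Fin n) (Fin n) ℝ := g.val.val.map Complex.re
  let B : Matrix (Fin n) (Fin n) ℝ := g.val.val.map Complex.im
  have hg1 : g.val.valᵀ * g.val.val = 1 := g.2.1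
  have hre : Aᵀ * A = 1 + Bᵀ * B := by
    ext i j
    have := congrArg Complex.re (congrFun (congrFun hg1 i) j)
    simp only [Matrix.mul_apply, Matrix.transpose_apply, Complex.re_sum, Complex.mul_re,
      Finset.sum_sub_distrib, Matrix.one_apply, apply_ite Complex.re, Complex.one_re,
      Complex.zero_re] at this
    simp only [Matrix.mul_apply, Matrix.add_apply, Matrix.transpose_apply, A, B, Matrix.map_apply,
      Matrix.one_apply]
    linarith
  have him : Aᵀ * B = -(Bᵀ * A) := by
    ext i j
    have := congrArg Complex.im (congrFun (congrFun hg1 i) j)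
    simp only [Matrix.mul_apply, Matrix.transpose_apply, Complex.im_sum, Complex.mul_im,
      Finset.sum_add_distrib, Matrix.one_apply, apply_ite Complex.im, Complex.one_im,
      Complex.zero_im, ite_self] at this
    simp only [Matrix.mul_apply, Matrix.neg_apply, Matrix.transpose_apply, A, B, Matrix.map_apply]
    linarith
  have hcol : ∀ i : Fin n, m < (i : ℕ) → ∀ j,
      g.val.val j i = Pi.single (M := fun _ => ℂ) i 1 j :=
    fun i hi j => by simpa using congrFun (hg i hi) j
  have hrow : ∀ i : Fin n, m < (i : ℕ) → ∀ j,
      g.val.val i j = Pi.single (M := fun _ => ℂ) i 1 j := by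
    intro i hi j
    have h1 : g.val.valᵀ *ᵥ (g.val.val *ᵥ Pi.single i 1) = Pi.single i 1 := by
      rw [Matrix.mulVec_mulVec, hg1, Matrix.one_mulVec]
    rw [hg i hi] at h1
    simpa using congrFun h1 j
  have hAdet : A.det ≠ 0 := by
    intro h
    obtain ⟨w, hw, hAw⟩ := Matrix.exists_mulVec_eq_zero_iff.mpr h
    have h1 : w ⬝ᵥ ((Aᵀ * A) *ᵥ w) = w ⬝ᵥ w + (B *ᵥ w) ⬝ᵥ (B *ᵥ w) := by
      rw [hre, Matrix.add_mulVec, Matrix.one_mulVec, dotProduct_add, ← Matrix.mulVec_mulVec,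
        Matrix.dotProduct_mulVec, Matrix.vecMul_transpose]
    rw [← Matrix.mulVec_mulVec, hAw, Matrix.mulVec_zero, dotProduct_zero] at h1
    have h2 : 0 ≤ w ⬝ᵥ w := Finset.sum_nonneg fun i _ => mul_self_nonneg _
    have h3 : 0 ≤ (B *ᵥ w) ⬝ᵥ (B *ᵥ w) := Finset.sum_nonneg fun i _ => mul_self_nonneg _
    exact hw (dotProduct_self_eq_zero.mp (by linarith))
  let e : Fin (m + 1) → Fin n := Fin.castLE hmn
  have he : Function.Injective e := Fin.castLE_injective hmn
  have hrange : ∀ i : Fin n, i ∈ Set.range e ↔ (i : ℕ) ≤ m := fun i =>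
    ⟨by rintro ⟨j, rfl⟩; exact Nat.le_of_lt_succ j.2,
      fun h => ⟨⟨i, Nat.lt_succ_of_le h⟩, rfl⟩⟩
  have hdet : ((Aᵀ * B).submatrix e e).det = 0 := by
    have h1 : ((Aᵀ * B).submatrix e e)ᵀ = -((Aᵀ * B).submatrix e e) := by
      have : (Aᵀ * B)ᵀ = -(Aᵀ * B) := by
        rw [Matrix.transpose_mul, Matrix.transpose_transpose, him, neg_neg]
      rw [Matrix.transpose_submatrix, this, Matrix.submatrix_neg]
      rfl
    have h2 := congrArg Matrix.det h1
    rw [Matrix.det_transpose, Matrix.det_neg, Fintype.card_fin, heven.add_one.neg_one_pow] at h2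
    linarith
  obtain ⟨x, hx, hSx⟩ := Matrix.exists_mulVec_eq_zero_iff.mpr hdet
  let y : Fin n → ℝ := Function.extend e x 0
  have hye : ∀ j, y (e j) = x j := fun j => he.extend_apply _ _ _
  have hys : ∀ i : Fin n, m < (i : ℕ) → y i = 0 := fun i hi =>
    Function.extend_apply' _ _ _ fun h => absurd ((hrange i).mp h) (by omega)
  have hABy : (Aᵀ * B) *ᵥ y = 0 := by
    ext i
    by_cases hi : (i : ℕ) ≤ m
    · obtain ⟨i, rfl⟩ := (hrange i).mpr hi
      refine Eq.trans ?_ (congrFun hSx i)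
      refine (Fintype.sum_of_injective e he _ _ (fun j hj => ?_) fun j => ?_).symm
      · rw [hys j (by rw [hrange] at hj; omega), mul_zero]
      · rw [hye]
        rfl
    · have hBi : ∀ j, B j i = 0 := fun j => by
        simp [B, hcol i (not_le.mp hi), Pi.single_apply, apply_ite Complex.im]
      rw [him, Matrix.neg_mulVec, ← Matrix.mulVec_mulVec, Pi.neg_apply, Matrix.mulVec, dotProduct]
      simp [hBi]
  have hBy : B *ᵥ y = 0 := by
    rw [← Matrix.mulVec_mulVec] at hABy
    exact Matrix.eq_zero_of_mulVec_eq_zero (by rwa [Matrix.det_transpose]) hABy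
  have hypos : 0 < y ⬝ᵥ y := by
    refine lt_of_le_of_ne (Finset.sum_nonneg fun i _ => mul_self_nonneg _) fun h => hx ?_
    have hy0 := dotProduct_self_eq_zero.mp h.symm
    ext j
    rw [← hye, hy0]
    rfl
  let r : ℝ := (√(y ⬝ᵥ y))⁻¹
  let v : Fin n → ℝ := r • y
  have hv : v ⬝ᵥ v = 1 := by
    simp only [v, r, smul_dotProduct, dotProduct_smul, smul_eq_mul]
    rw [← mul_assoc, ← mul_inv, Real.mul_self_sqrt hypos.le, inv_mul_cancel₀ hypos.ne']
  have hvs : ∀ i : Fin n, m < (i : ℕ) → v i = 0 := fun i hi => by simp [v, hys i hi]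
  have hBv : B *ᵥ v = 0 := by rw [Matrix.mulVec_smul, hBy, smul_zero]
  refine ⟨v, A *ᵥ v, hv, ?_, hvs, fun i hi => ?_, ?_⟩
  · rw [Matrix.dotProduct_mulVec, ← Matrix.mulVec_transpose, Matrix.mulVec_mulVec, hre,
      Matrix.add_mulVec, Matrix.one_mulVec, ← Matrix.mulVec_mulVec, hBv, Matrix.mulVec_zero,
      add_zero, hv]
  · simp [Matrix.mulVec, dotProduct, A, hrow i hi, Pi.single_apply, apply_ite Complex.re,
      hvs i hi]
  · ext i
    apply Complex.ext
    · simp [Matrix.mulVec, dotProduct, A]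
    · simpa [Matrix.mulVec, dotProduct, B] using congrFun hBv i

/-- For even `m`, `SO(m + 1, ℂ)` is contained in `K SO(m, ℂ) K` with `K` a bounded set. -/
theorem complexSO.exists_cartan {m n : ℕ} (hm : 0 < m) (hmn : m < n) (heven : Even m)
    (g : complexSO n) (hg : g ∈ complexSOsub (m + 1) n) :
    ∃ k k' : complexSO n, (∀ i j, ‖k.val.val i j‖ ≤ 1) ∧ (∀ i j, ‖k'.val.val i j‖ ≤ 1) ∧
      k⁻¹ * g * k' ∈ complexSOsub m n := by
  obtain ⟨v, u, hv, hu, hvs, hus, hgv⟩ := complexSO.exists_real_vector hmn heven g hg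
  obtain ⟨k', hk', hk'm, hk's⟩ := complexSO.exists_rotation hm hmn v hv hvs
  obtain ⟨k, hk, hkm, hks⟩ := complexSO.exists_rotation hm hmn u hu hus
  refine ⟨k, k', hk, hk', ?_⟩
  have hinv : (k⁻¹).val.val * k.val.val = 1 := Units.inv_mul k.val
  have hmul : (k⁻¹ * g * k').val.val = (k⁻¹).val.val * g.val.val * k'.val.val := rfl
  have aux : ∀ x y z : Fin n → ℂ, k'.val.val *ᵥ x = y → g.val.val *ᵥ y = z →
      k.val.val *ᵥ x = z → (k⁻¹ * g * k').val.val *ᵥ x = x := by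
    rintro x y z rfl rfl h
    rw [hmul, ← Matrix.mulVec_mulVec, ← Matrix.mulVec_mulVec, ← h, Matrix.mulVec_mulVec, hinv,
      Matrix.one_mulVec]
  intro i hi
  rcases hi.eq_or_lt with h | h
  · obtain rfl : i = ⟨m, hmn⟩ := Fin.ext h.symm
    exact aux _ _ _ hk'm hgv hkm
  · exact aux _ _ _ (hk's i h) (hg i h) (hks i h)

/-- `SO(m + 1, ℂ) / SO(m, ℂ)` is unbounded. -/
theorem complexSO.exists_boost {m n : ℕ} (hm : 0 < m) (hmn : m < n) (t : ℝ) :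
    ∃ g ∈ complexSOsub (m + 1) n,
      ‖g.val.val ⟨m, hmn⟩ ⟨m, hmn⟩‖ = 1 + 2 * t ^ 2 := by
  let p : Fin n := ⟨0, hm.trans hmn⟩
  let q : Fin n := ⟨m, hmn⟩
  have hpq : p ≠ q := fun h => hm.ne (congrArg Fin.val h)
  let y : Fin n → ℂ := Pi.single q (√(1 + t ^ 2) : ℂ) + Pi.single p (t * Complex.I)
  have hsq : ((√(1 + t ^ 2) : ℝ) : ℂ) * (√(1 + t ^ 2) : ℝ) = 1 + (t : ℂ) ^ 2 := by
    rw [← Complex.ofReal_mul, Real.mul_self_sqrt (by positivity)]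
    push_cast
    rfl
  have hy : y ⬝ᵥ y = 1 := by
    simp only [y, add_dotProduct, dotProduct_add, single_dotProduct, Pi.single_eq_same,
      Pi.single_eq_of_ne hpq, Pi.single_eq_of_ne hpq.symm, hsq]
    linear_combination (t : ℂ) ^ 2 * Complex.I_mul_I
  let r : Matrix (Fin n) (Fin n) ℂ := 1 - Matrix.vecMulVec ((2 : ℂ) • y) y
  have hr : rᵀ * r = 1 := by
    simp only [r, Matrix.transpose_sub, Matrix.transpose_one, Matrix.smul_vecMulVec,
      Matrix.transpose_smul, Matrix.transpose_vecMulVec, sub_mul, mul_sub, one_mul, mul_one,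
      smul_mul_assoc, mul_smul_comm, Matrix.vecMulVec_mul_vecMulVec, hy, one_smul]
    module
  have hrd : r.det = -1 := by
    have := Matrix.det_one_add_replicateCol_mul_replicateRow (ι := Unit) (-((2 : ℂ) • y)) y
    rw [← Matrix.vecMulVec_eq, Matrix.neg_vecMulVec, ← sub_eq_add_neg, dotProduct_neg,
      dotProduct_smul, hy] at this
    rw [this]
    norm_num
  let d : Fin n → ℂ := Function.update 1 q (-1)
  have hd : Matrix.diagonal d * Matrix.diagonal d = 1 := by
    rw [Matrix.diagonal_mul_diagonal, ← Matrix.diagonal_one]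
    congr 1
    ext i
    by_cases h : i = q <;> simp [d, h]
  have hdd : (Matrix.diagonal d).det = -1 := by
    rw [Matrix.det_diagonal, Finset.prod_update_of_mem (Finset.mem_univ _)]
    simp
  refine ⟨complexSO.ofMatrix (r * Matrix.diagonal d) ?_ ?_, ?_, ?_⟩
  · rw [Matrix.transpose_mul, Matrix.diagonal_transpose, Matrix.mul_assoc, ← Matrix.mul_assoc rᵀ,
      hr, Matrix.one_mul, hd]
  · rw [Matrix.det_mul, hrd, hdd]
    norm_num
  · intro i hi
    have hip : i ≠ p := by rintro rfl; simp [p] at hi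
    have hiq : i ≠ q := by rintro rfl; simp [q] at hi
    have hyi : y i = 0 := by simp [y, hip, hiq]
    ext j
    simp [complexSO.ofMatrix, r, Matrix.vecMulVec_apply, hyi, d, hiq, Matrix.one_apply,
      Pi.single_apply]
  · have hyq : y q = (√(1 + t ^ 2) : ℝ) := by simp [y, hpq]
    have : (r * Matrix.diagonal d) q q = ((1 + 2 * t ^ 2 : ℝ) : ℂ) := by
      simp only [Matrix.mul_diagonal, r, Matrix.sub_apply, Matrix.one_apply_eq,
        Matrix.vecMulVec_apply, Pi.smul_apply, smul_eq_mul, hyq, d, Function.update_self]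
      push_cast
      linear_combination 2 * hsq
    change ‖(r * Matrix.diagonal d) q q‖ = _
    rw [this, Complex.norm_real, Real.norm_of_nonneg (by positivity)]

/-- **No compact Clifford–Klein forms for `SO(n,ℂ)/SO(m,ℂ)`, `m` even.**
If `1 < m < n` and `m` is even, there is no discrete subgroup `Γ` of `G = SO(n,ℂ)` acting
properly discontinuously and cocompactly on the homogeneous space `G/H`,
where `H` is the standard copy of `SO(m,ℂ)`. -/
theorem no_compact_CliffordKlein_form_complexSO_complexSO (m n : ℕ) (h1m : 1 < m)
    (hmn : m < n) (heven : Even m) :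
    ¬ ∃ Γ : Subgroup ↥(complexSO n), DiscreteTopology ↥Γ ∧
      ProperlyDiscontinuousSMul ↥Γ (↥(complexSO n) ⧸ complexSOsub m n) ∧
      CompactSpace (MulAction.orbitRel.Quotient ↥Γ (↥(complexSO n) ⧸ complexSOsub m n)) := by
  rintro ⟨Γ, -, hΓ, hc⟩
  have hm : 0 < m := by omega
  obtain ⟨R, hR⟩ := complexSO.exists_bound_of_cocompact Γ (complexSOsub m n)
  open scoped Pointwise in
  let B : ℝ → Set (complexSO n) := fun r => {g | ∀ i j, ‖g.val.val i j‖ ≤ r}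
  have hB : ∀ r, IsCompact (B r) := complexSO.isCompact_entries_le n
  let π : complexSO n → complexSO n ⧸ complexSOsub m n := QuotientGroup.mk
  have hπ : Continuous π := QuotientGroup.continuous_mk
  have hfin := hΓ.finite_disjoint_inter_image (((hB R).mul (hB 1)).image hπ) ((hB 1).image hπ)
  set F : Set Γ := {γ | _} with hF
  have hcpt : IsCompact ((fun γ : Γ => (γ : complexSO n)) '' F * B R) :=
    (hfin.image _).isCompact.mul (hB R)
  obtain ⟨M, hM⟩ := (hcpt.image (f := fun g : complexSO n => ‖g.val.val ⟨m, hmn⟩ ⟨m, hmn⟩‖)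
    ((Units.continuous_val.comp continuous_subtype_val).matrix_elem _ _).norm).bddAbove
  obtain ⟨g, hg, hgM⟩ := complexSO.exists_boost hm hmn (M + 1)
  obtain ⟨γ, hγ, c, h, hh, hcR, hgeq⟩ := hR g
  have hsub : h⁻¹ ∈ complexSOsub (m + 1) n :=
    (complexSOsub m n).inv_mem hh |> fun h' i hi => h' i (Nat.le_of_succ_le hi)
  obtain ⟨k, k', hk, hk', hkk⟩ := complexSO.exists_cartan hm hmn heven (g * h⁻¹)
    (mul_mem hg hsub)
  have hγF : (⟨γ, hγ⟩ : Γ) ∈ F := by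
    refine ⟨π k, ⟨π (c * k'), ⟨_, Set.mul_mem_mul hcR hk', rfl⟩, ?_⟩, ⟨k, hk, rfl⟩⟩
    refine (QuotientGroup.eq.mpr ?_ : π k = π (γ * (c * k'))).symm
    convert hkk using 1
    rw [hgeq]
    group
  have hcol : g.val.val ⟨m, hmn⟩ ⟨m, hmn⟩ = (γ * c).val.val ⟨m, hmn⟩ ⟨m, hmn⟩ := by
    have h1 : g.val.val *ᵥ Pi.single ⟨m, hmn⟩ 1 = (γ * c).val.val *ᵥ Pi.single ⟨m, hmn⟩ 1 := by
      have h2 : g.val.val = (γ * c).val.val * h.val.val := by rw [hgeq]; rfl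
      rw [h2, ← Matrix.mulVec_mulVec, hh ⟨m, hmn⟩ le_rfl]
    simpa using congrFun h1 ⟨m, hmn⟩
  have hle := hM ⟨γ * c, Set.mul_mem_mul ⟨⟨γ, hγ⟩, hγF, rfl⟩ hcR, rfl⟩
  simp only [← hcol, hgM] at hle
  nlinarith [sq_nonneg (M + 1)]
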